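/- Let (X,d,≤) be a quasi-ordered metric space which is complete (every ascending Cauchy sequence converges), let T : X → X be ≤-increasing with {x ∈ X : x ≤ Tx} nonempty, and suppose that either T is ≤-continuous or the relation ≤ is self-closed. Let F : [0,∞)^6 → ℝ be compatible, almost 2-right-lim-positive, 4-point-lim-positive, and in addition (3,4)-normal (F(r,r,0,0,r,r) > 0 for all r > 0), and assume T is (d,≤;M;F)-contractive. Then T is a global Picard operator modulo (d,≤): for every x ∈ X with x ≤ Tx the sequence (T^n x) converges to a fixed point of T, and any two fixed points z, w of T with z ≤ w are equal. -/

import Mathlib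

open Filter Topology
open scoped NNReal

/-- `F : [0,∞)^6 → ℝ` is compatible: for all sequences `(r n)` in `(0,∞)` and `(s n)` in
`[0,∞)` with `F (r (n+1)) (r n) (r n) (r (n+1)) (s n) 0 ≤ 0` and `|s n - r n| ≤ r (n+1)`
for all `n`, one has `r n → 0`. -/
def FCompatible (F : ℝ≥0 → ℝ≥0 → ℝ≥0 → ℝ≥0 → ℝ≥0 → ℝ≥0 → ℝ) : Prop :=
  ∀ r s : ℕ → ℝ≥0, (∀ n, 0 < r n) →
    (∀ n, F (r (n + 1)) (r n) (r n) (r (n + 1)) (s n) 0 ≤ 0) →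
    (∀ n, |(s n : ℝ) - (r n : ℝ)| ≤ (r (n + 1) : ℝ)) →
    Filter.Tendsto r Filter.atTop (nhds 0)

/-- `F` is 2-right-lim-positive at `b`: for every sequence of points of `(0,∞)^6` whose
components tend respectively to `b`, `b` (from the strict right), `0`, `0`, `b`, `b`,
the `limsup` of the values of `F` is positive. -/
def TwoRightLimPositiveAt (F : ℝ≥0 → ℝ≥0 → ℝ≥0 → ℝ≥0 → ℝ≥0 → ℝ≥0 → ℝ) (b : ℝ≥0) : Prop :=
  ∀ t₁ t₂ t₃ t₄ t₅ t₆ : ℕ → ℝ≥0,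
    (∀ n, 0 < t₁ n) → (∀ n, 0 < t₂ n) → (∀ n, 0 < t₃ n) →
    (∀ n, 0 < t₄ n) → (∀ n, 0 < t₅ n) → (∀ n, 0 < t₆ n) →
    Filter.Tendsto t₁ Filter.atTop (nhds b) →
    Filter.Tendsto t₂ Filter.atTop (nhds b) → (∀ n, b < t₂ n) →
    Filter.Tendsto t₃ Filter.atTop (nhds 0) →
    Filter.Tendsto t₄ Filter.atTop (nhds 0) →
    Filter.Tendsto t₅ Filter.atTop (nhds b) →
    Filter.Tendsto t₆ Filter.atTop (nhds b) →
    0 < Filter.limsup (fun n => F (t₁ n) (t₂ n) (t₃ n) (t₄ n) (t₅ n) (t₆ n)) Filter.atTop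

/-- `F` is almost 2-right-lim-positive: the set of `b > 0` at which `F` is
2-right-lim-positive is `(>)`-cofinal in `(0,∞)`. -/
def AlmostTwoRightLimPositive (F : ℝ≥0 → ℝ≥0 → ℝ≥0 → ℝ≥0 → ℝ≥0 → ℝ≥0 → ℝ) : Prop :=
  ∀ ε : ℝ≥0, 0 < ε → ∃ b : ℝ≥0, 0 < b ∧ b < ε ∧ TwoRightLimPositiveAt F b

/-- `F` is 4-point-lim-positive at `b`: for every sequence of points of `(0,∞)^6` whose
components tend respectively to `b`, `0`, `0`, are constantly `b`, tend to `b`, `0`,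
the `limsup` of the values of `F` is positive. -/
def FourPointLimPositiveAt (F : ℝ≥0 → ℝ≥0 → ℝ≥0 → ℝ≥0 → ℝ≥0 → ℝ≥0 → ℝ) (b : ℝ≥0) : Prop :=
  ∀ t₁ t₂ t₃ t₅ t₆ : ℕ → ℝ≥0,
    (∀ n, 0 < t₁ n) → (∀ n, 0 < t₂ n) → (∀ n, 0 < t₃ n) →
    (∀ n, 0 < t₅ n) → (∀ n, 0 < t₆ n) →
    Filter.Tendsto t₁ Filter.atTop (nhds b) →
    Filter.Tendsto t₂ Filter.atTop (nhds 0) →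
    Filter.Tendsto t₃ Filter.atTop (nhds 0) →
    Filter.Tendsto t₅ Filter.atTop (nhds b) →
    Filter.Tendsto t₆ Filter.atTop (nhds 0) →
    0 < Filter.limsup (fun n => F (t₁ n) (t₂ n) (t₃ n) b (t₅ n) (t₆ n)) Filter.atTop

/-- `F` is 4-point-lim-positive: it is 4-point-lim-positive at every `b > 0`. -/
def FourPointLimPositive (F : ℝ≥0 → ℝ≥0 → ℝ≥0 → ℝ≥0 → ℝ≥0 → ℝ≥0 → ℝ) : Prop :=
  ∀ b : ℝ≥0, 0 < b → FourPointLimPositiveAt F b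

theorem aux_not_limsup_pos (u : ℕ → ℝ) (h : ∀ n, u n ≤ 0) :
    ¬ 0 < Filter.limsup u Filter.atTop := by
  rw [Filter.limsup_eq]
  have h0 : (0 : ℝ) ∈ {a | ∀ᶠ n in atTop, u n ≤ a} := Eventually.of_forall h
  by_cases hb : BddBelow {a | ∀ᶠ n in atTop, u n ≤ a}
  · exact not_lt.mpr (csInf_le hb h0)
  · rw [Real.sInf_of_not_bddBelow hb]
    exact lt_irrefl _

theorem aux_tendsto (t : ℕ → ℝ≥0) (b : ℝ≥0) (e : ℕ → ℝ) (he : Tendsto e atTop (nhds 0))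
    (h : ∀ n, |(t n : ℝ) - b| ≤ e n) : Tendsto t atTop (nhds b) := by
  rw [← NNReal.tendsto_coe, tendsto_iff_dist_tendsto_zero]
  exact squeeze_zero (fun _ => dist_nonneg) (fun n => by rw [Real.dist_eq]; exact h n) he

theorem aux_cauchy {X : Type*} [MetricSpace X] (le : X → X → Prop) (T : X → X)
    (F : ℝ≥0 → ℝ≥0 → ℝ≥0 → ℝ≥0 → ℝ≥0 → ℝ≥0 → ℝ)
    (hF2 : AlmostTwoRightLimPositive F)
    (hcontr : ∀ x y, le x y → x ≠ y →
      F (nndist (T x) (T y)) (nndist x y) (nndist x (T x)) (nndist y (T y))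
        (nndist x (T y)) (nndist (T x) y) ≤ 0)
    (x : ℕ → X) (hx : ∀ n, T (x n) = x (n + 1)) (hle : ∀ m n, m ≤ n → le (x m) (x n))
    (hpos : ∀ n, x n ≠ x (n + 1))
    (hr : Tendsto (fun n => dist (x n) (x (n + 1))) atTop (nhds 0)) : CauchySeq x := by
  by_contra hC
  rw [Metric.cauchySeq_iff'] at hC
  push Not at hC
  obtain ⟨ε, hε, hC⟩ := hC
  obtain ⟨b, hb0, hbε, hb⟩ := hF2 ⟨ε, hε.le⟩ hε
  have hb0' : (0 : ℝ) < b := hb0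
  have hbε' : (b : ℝ) < ε := hbε
  have key : ∀ k : ℕ, ∃ n m : ℕ, n ≤ m ∧ (b : ℝ) < dist (x n) (x m) ∧
      dist (x n) (x m) ≤ b + b / 4 * (1 / ((k : ℝ) + 1)) ∧
      dist (x n) (x (n + 1)) ≤ b / 4 * (1 / ((k : ℝ) + 1)) ∧
      dist (x m) (x (m + 1)) ≤ b / 4 * (1 / ((k : ℝ) + 1)) := by
    intro k
    have hδ : 0 < (b : ℝ) / 4 * (1 / ((k : ℝ) + 1)) := by positivity
    obtain ⟨n, hn⟩ := eventually_atTop.1 (hr.eventually (gt_mem_nhds hδ))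
    have hex : ∃ m, n ≤ m ∧ (b : ℝ) < dist (x n) (x m) := by
      obtain ⟨m, hm, hd⟩ := hC n
      exact ⟨m, hm, by rw [dist_comm]; linarith⟩
    classical
    obtain ⟨h1, h2⟩ := Nat.find_spec hex
    have hmin := fun j => Nat.find_min hex (m := j)
    generalize Nat.find hex = m at *
    obtain ⟨j, rfl⟩ : ∃ j, m = j + 1 := by
      cases m with
      | zero =>
        obtain rfl : n = 0 := by omega
        rw [dist_self] at h2
        linarith
      | succ j => exact ⟨j, rfl⟩
    have hnj : n ≤ j := by
      by_contra hlt
      obtain rfl : n = j + 1 := by omega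
      rw [dist_self] at h2
      linarith
    have h3 : dist (x n) (x j) ≤ b := by
      by_contra h
      exact hmin j (by omega) ⟨hnj, not_le.1 h⟩
    refine ⟨n, j + 1, h1, h2, ?_, (hn n le_rfl).le, (hn _ h1).le⟩
    have := dist_triangle (x n) (x j) (x (j + 1))
    have := hn j hnj
    linarith
  choose n m hnm h1 h2 h3 h4 using key
  have hδ : ∀ k : ℕ, (b : ℝ) / 4 * (1 / ((k : ℝ) + 1)) ≤ b / 4 := by
    intro k
    have : 1 / ((k : ℝ) + 1) ≤ 1 := by
      rw [div_le_one (by positivity)]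
      have : (0 : ℝ) ≤ k := by positivity
      linarith
    nlinarith
  have he : Tendsto (fun k : ℕ => 3 * ((b : ℝ) / 4 * (1 / ((k : ℝ) + 1)))) atTop (nhds 0) := by
    have := (tendsto_one_div_add_atTop_nhds_zero_nat (𝕜 := ℝ)).const_mul ((b : ℝ) / 4)
    simpa using this.const_mul 3
  have b5 : ∀ k, |dist (x (n k)) (x (m k + 1)) - b| ≤ 3 * ((b : ℝ) / 4 * (1 / ((k : ℝ) + 1))) := by
    intro k
    have := h1 k; have := h2 k; have := h3 k; have := h4 k
    have := dist_triangle (x (n k)) (x (m k)) (x (m k + 1))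
    have := dist_triangle_right (x (n k)) (x (m k)) (x (m k + 1))
    rw [abs_le]; constructor <;> linarith [dist_nonneg (x := x (n k)) (y := x (n k + 1))]
  have b6 : ∀ k, |dist (x (n k + 1)) (x (m k)) - b| ≤ 3 * ((b : ℝ) / 4 * (1 / ((k : ℝ) + 1))) := by
    intro k
    have := h1 k; have := h2 k; have := h3 k; have := h4 k
    have := dist_triangle (x (n k)) (x (n k + 1)) (x (m k))
    have := dist_triangle_left (x (n k + 1)) (x (m k)) (x (n k))
    rw [abs_le]; constructor <;> linarith [dist_nonneg (x := x (n k)) (y := x (n k + 1))]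
  have b1 : ∀ k, |dist (x (n k + 1)) (x (m k + 1)) - b|
      ≤ 3 * ((b : ℝ) / 4 * (1 / ((k : ℝ) + 1))) := by
    intro k
    have := h1 k; have := h2 k; have := h3 k; have := h4 k
    have := dist_triangle4 (x (n k)) (x (n k + 1)) (x (m k + 1)) (x (m k))
    have := dist_triangle4 (x (n k + 1)) (x (n k)) (x (m k)) (x (m k + 1))
    rw [dist_comm (x (n k + 1)) (x (n k))] at this
    rw [dist_comm (x (m k + 1)) (x (m k))] at *
    rw [abs_le]; constructor <;> linarith [dist_nonneg (x := x (n k)) (y := x (n k + 1))]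
  have hp : ∀ (k : ℕ) (d : ℝ≥0), |(d : ℝ) - b| ≤ 3 * ((b : ℝ) / 4 * (1 / ((k : ℝ) + 1))) →
      0 < d := by
    intro k d hd
    have := hδ k
    rw [abs_le] at hd
    have : (0 : ℝ) < d := by linarith
    exact_mod_cast this
  have hps : ∀ j, 0 < nndist (x j) (x (j + 1)) := fun j => by
    rw [pos_iff_ne_zero, Ne, nndist_eq_zero]; exact hpos j
  refine aux_not_limsup_pos _ ?_ (hb
    (fun k => nndist (x (n k + 1)) (x (m k + 1))) (fun k => nndist (x (n k)) (x (m k)))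
    (fun k => nndist (x (n k)) (x (n k + 1))) (fun k => nndist (x (m k)) (x (m k + 1)))
    (fun k => nndist (x (n k)) (x (m k + 1))) (fun k => nndist (x (n k + 1)) (x (m k)))
    (fun k => hp k _ (b1 k)) (fun k => lt_trans hb0 (h1 k))
    (fun k => hps _) (fun k => hps _) (fun k => hp k _ (b5 k)) (fun k => hp k _ (b6 k))
    (aux_tendsto _ _ _ he b1) (aux_tendsto _ _ _ he ?_) (fun k => h1 k)
    (aux_tendsto _ _ _ he ?_) (aux_tendsto _ _ _ he ?_)
    (aux_tendsto _ _ _ he b5) (aux_tendsto _ _ _ he b6))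
  · intro k
    have hne : x (n k) ≠ x (m k) := by
      intro h
      have := h1 k
      rw [h, dist_self] at this
      linarith
    have := hcontr _ _ (hle _ _ (hnm k)) hne
    simpa only [hx] using this
  · intro k
    have := h1 k; have := h2 k
    have h0 : 0 ≤ (b : ℝ) / 4 * (1 / ((k : ℝ) + 1)) := by positivity
    rw [coe_nndist, abs_le]; constructor <;> linarith
  · intro k
    have h0 : 0 ≤ (b : ℝ) / 4 * (1 / ((k : ℝ) + 1)) := by positivity
    have := h3 k
    rw [coe_nndist, NNReal.coe_zero, sub_zero, abs_of_nonneg dist_nonneg]; linarith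
  · intro k
    have h0 : 0 ≤ (b : ℝ) / 4 * (1 / ((k : ℝ) + 1)) := by positivity
    have := h4 k
    rw [coe_nndist, NNReal.coe_zero, sub_zero, abs_of_nonneg dist_nonneg]; linarith

/-- **Theorem 3.1, parts I + II (main result).**
Under the hypotheses of the implicit fixed point principle, if in addition `F` is
(3,4)-normal (`F r r 0 0 r r > 0` for all `r > 0`), then `T` is a global Picard operator:
for each `x` with `le x (T x)`, `T^[n] x` converges to a fixed point of `T`, and any two
comparable fixed points coincide. -/
theorem global_picard_of_implicit_contraction
    {X : Type*} [MetricSpace X]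
    (le : X → X → Prop)
    (hrefl : ∀ x, le x x)
    (htrans : ∀ x y z, le x y → le y z → le x z)
    (hcomplete : ∀ x : ℕ → X, (∀ n, le (x n) (x (n + 1))) → CauchySeq x →
      ∃ a, Tendsto x atTop (nhds a))
    (T : X → X)
    (hmono : ∀ x y, le x y → le (T x) (T y))
    (hne : ∃ x, le x (T x))
    (hreg :
      (∀ (x : ℕ → X) (a : X), (∀ n, le (x n) (x (n + 1))) →
        Tendsto x atTop (nhds a) →
        Tendsto (fun n => T (x n)) atTop (nhds (T a)))
      ∨
      (∀ (x : ℕ → X) (a : X), (∀ n, le (x n) (x (n + 1))) →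
        Tendsto x atTop (nhds a) → ∀ n, le (x n) a))
    (F : ℝ≥0 → ℝ≥0 → ℝ≥0 → ℝ≥0 → ℝ≥0 → ℝ≥0 → ℝ)
    (hFcomp : FCompatible F)
    (hF2 : AlmostTwoRightLimPositive F)
    (hF4 : FourPointLimPositive F)
    (hFnormal : ∀ r : ℝ≥0, 0 < r → 0 < F r r 0 0 r r)
    (hcontr : ∀ x y, le x y → x ≠ y →
      F (nndist (T x) (T y)) (nndist x y) (nndist x (T x)) (nndist y (T y))
        (nndist x (T y)) (nndist (T x) y) ≤ 0) :
    (∀ x, le x (T x) →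
      ∃ z, Tendsto (fun n => T^[n] x) atTop (nhds z) ∧ T z = z) ∧
    (∀ z w, T z = z → T w = w → le z w → z = w) := by
  refine ⟨?_, ?_⟩
  · intro x₀ hx₀
    obtain ⟨x, hxdef⟩ : ∃ x : ℕ → X, x = fun n => T^[n] x₀ := ⟨_, rfl⟩
    have hx : ∀ n, T (x n) = x (n + 1) := fun n => by
      rw [hxdef]; exact (Function.iterate_succ_apply' T n x₀).symm
    have hasc : ∀ n, le (x n) (x (n + 1)) := by
      intro n
      induction n with
      | zero => simpa [hxdef] using hx₀
      | succ k ih => rw [← hx k, ← hx (k + 1)]; exact hmono _ _ ih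
    have hle : ∀ m n, m ≤ n → le (x m) (x n) := by
      intro m n h
      induction n, h using Nat.le_induction with
      | base => exact hrefl _
      | succ k _ ih => exact htrans _ _ _ ih (hasc k)
    rw [← hxdef]
    by_cases hpos : ∀ n, x n ≠ x (n + 1)
    swap
    · push Not at hpos
      obtain ⟨N, hN⟩ := hpos
      have hc : ∀ n, N ≤ n → x n = x N := by
        intro n h
        induction n, h using Nat.le_induction with
        | base => rfl
        | succ k _ ih => rw [← hx k, ih, hx N, ← hN]
      refine ⟨x N, tendsto_const_nhds.congr' ?_, by rw [hx N, ← hN]⟩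
      filter_upwards [eventually_ge_atTop N] with n hn
      exact (hc n hn).symm
    have hps : ∀ j, 0 < nndist (x j) (x (j + 1)) := fun j => by
      rw [pos_iff_ne_zero, Ne, nndist_eq_zero]; exact hpos j
    have hr : Tendsto (fun n => nndist (x n) (x (n + 1))) atTop (nhds 0) := by
      refine hFcomp _ (fun n => nndist (x n) (x (n + 2))) hps ?_ ?_
      · intro n
        have := hcontr _ _ (hasc n) (hpos n)
        simpa only [hx, nndist_self] using this
      · intro n
        have := dist_triangle (x n) (x (n + 1)) (x (n + 2))
        have := dist_triangle_right (x n) (x (n + 1)) (x (n + 2))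
        simp only [coe_nndist]
        rw [abs_le]
        constructor <;> linarith
    have hr' : Tendsto (fun n => dist (x n) (x (n + 1))) atTop (nhds 0) := by
      have := NNReal.tendsto_coe.2 hr
      simpa using this
    obtain ⟨z, hz⟩ := hcomplete x hasc (aux_cauchy le T F hF2 hcontr x hx hle hpos hr')
    have hz1 : Tendsto (fun n => x (n + 1)) atTop (nhds z) := (tendsto_add_atTop_iff_nat 1).2 hz
    refine ⟨z, hz, ?_⟩
    rcases hreg with hcont | hself
    · have := hcont x z hasc hz
      simp only [hx] at this
      exact tendsto_nhds_unique this hz1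
    · by_contra hne'
      have hzle := hself x z hasc hz
      have hb : 0 < nndist z (T z) := by
        rw [pos_iff_ne_zero, Ne, nndist_eq_zero]; exact fun h => hne' h.symm
      have e1 : ∀ᶠ n in atTop, x n ≠ T z := hz.eventually_ne (fun h => hne' h.symm)
      have e2 : ∀ᶠ n in atTop, x n ≠ z := by
        filter_upwards [(tendsto_add_atTop_nat 1).eventually e1] with n hn h
        exact hn (by rw [← hx n, h])
      obtain ⟨N, hN⟩ := eventually_atTop.1 (e1.and e2)
      have hzN : Tendsto (fun n => x (n + N)) atTop (nhds z) := (tendsto_add_atTop_iff_nat N).2 hz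
      have hzN1 : Tendsto (fun n => x (n + N + 1)) atTop (nhds z) :=
        (tendsto_add_atTop_iff_nat N).2 hz1
      have hlim : ∀ (u : ℕ → X) (w : X), Tendsto u atTop (nhds z) →
          Tendsto (fun n => nndist (u n) w) atTop (nhds (nndist z w)) :=
        fun u w hu => hu.nndist tendsto_const_nhds
      have hlim0 : ∀ (u : ℕ → X), Tendsto u atTop (nhds z) →
          Tendsto (fun n => nndist (u n) z) atTop (nhds 0) := by
        intro u hu
        simpa using hlim u z hu
      have hp : ∀ a c : X, a ≠ c → 0 < nndist a c := fun a c h => by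
        rw [pos_iff_ne_zero, Ne, nndist_eq_zero]; exact h
      refine aux_not_limsup_pos _ ?_ (hF4 _ hb
        (fun n => nndist (x (n + N + 1)) (T z)) (fun n => nndist (x (n + N)) z)
        (fun n => nndist (x (n + N)) (x (n + N + 1))) (fun n => nndist (x (n + N)) (T z))
        (fun n => nndist (x (n + N + 1)) z)
        (fun n => hp _ _ (hN _ (by omega)).1) (fun n => hp _ _ (hN _ (by omega)).2)
        (fun n => hps _) (fun n => hp _ _ (hN _ (by omega)).1)
        (fun n => hp _ _ (hN _ (by omega)).2)
        (hlim _ _ hzN1) (hlim0 _ hzN)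
        ((tendsto_add_atTop_iff_nat (f := fun n => nndist (x n) (x (n + 1))) N).2 hr)
        (hlim _ _ hzN) (hlim0 _ hzN1))
      intro n
      have := hcontr _ _ (hzle (n + N)) (hN _ (by omega)).2
      simpa only [hx] using this
  · intro z w hz hw hzw
    by_contra hne'
    have h := hcontr z w hzw hne'
    rw [hz, hw, nndist_self, nndist_self] at h
    have := hFnormal (nndist z w) (by rw [pos_iff_ne_zero, Ne, nndist_eq_zero]; exact hne')
    linarith
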